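/- Let L = ∑_{k=0}^{n}(−1)^k a_k(x)σ_q^{n−k} be an n-th order q-difference operator with polynomial coefficients and let s ∈ ℂ^×. Assume a_0(x) has simple zeros at x = q^{−j}s for 0 ≤ j ≤ n−2, a_n(x) has simple zeros at x = q^{−j}s for 1 ≤ j ≤ n−1, and neither a_0 nor a_n has any other zero of the form q^j s, j ∈ ℤ. Suppose in addition: (i) for 1 ≤ k ≤ n−1, the rational function t_k(x) is holomorphic at x = q^{−j}s for every j ∈ ℤ with j ≠ n−k and j ≠ n−k−1; (ii) for 2 ≤ k ≤ n−1, t_k(q^{−n+1}s) = 0; (iii) for 1 ≤ k ≤ n−1, the rational function t_k(q^{−n+k+1}x)·t_1(q^{−n+1}x) − t_{k+1}(q^{−n+k+1}x) is holomorphic at x = s. Then the points x = q^{−j}s, 0 ≤ j ≤ n−1, are apparent singularities of the companion system Y(qx) = A(x)Y(x). -/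

import Mathlib

open Polynomial

noncomputable section

/-- The rational function `x ↦ f (c * x)`. -/
def qshift (c : ℂ) (f : RatFunc ℂ) : RatFunc ℂ :=
  algebraMap (Polynomial ℂ) (RatFunc ℂ) (f.num.comp (C c * X)) /
    algebraMap (Polynomial ℂ) (RatFunc ℂ) (f.denom.comp (C c * X))

/-- `t_k = a_k / a_0`, with the convention `t_k = 0` for `k < 0` or `k > n`. -/
def tcoef (n : ℕ) (a : ℕ → Polynomial ℂ) (k : ℤ) : RatFunc ℂ :=
  if 0 ≤ k ∧ k ≤ (n : ℤ) then
    algebraMap (Polynomial ℂ) (RatFunc ℂ) (a k.toNat) /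
      algebraMap (Polynomial ℂ) (RatFunc ℂ) (a 0)
  else 0

/-- The `n × n` companion matrix `A(x)`. -/
def companion (n : ℕ) (t : ℤ → RatFunc ℂ) : Matrix (Fin n) (Fin n) (RatFunc ℂ) :=
  Matrix.of fun i j =>
    if (i : ℕ) = 0 then (-1 : RatFunc ℂ) ^ (j : ℕ) * t (((j : ℕ) : ℤ) + 1)
    else if (i : ℕ) = (j : ℕ) + 1 then 1 else 0

/-- A matrix of rational functions is *regular* at `s` if all its entries are
holomorphic at `s` and the value matrix at `s` is invertible. -/
def RegularAt {n : ℕ} (M : Matrix (Fin n) (Fin n) (RatFunc ℂ)) (s : ℂ) : Prop :=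
  (∀ i j, (M i j).denom.eval s ≠ 0) ∧
    (Matrix.of fun i j => RatFunc.eval (RingHom.id ℂ) s (M i j)).det ≠ 0

/-- `s` is an apparent singularity of the system `Y(qx) = A(x) Y(x)`. -/
def IsApparent {n : ℕ} (q : ℂ) (A : Matrix (Fin n) (Fin n) (RatFunc ℂ)) (s : ℂ) : Prop :=
  ∃ N0 : ℕ, ∀ N N' : ℕ, N0 ≤ N → N0 ≤ N' →
    RegularAt (((List.range (N + N' + 1)).map fun k =>
      A.map (qshift (q ^ ((N : ℤ) - (k : ℤ))))).prod) s

/-- The ring of rational functions which are holomorphic at `p`. -/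
def holAt (p : ℂ) : Subring (RatFunc ℂ) where
  carrier := {f | f.denom.eval p ≠ 0}
  mul_mem' {f g} hf hg h := by
    have := eval_eq_zero_of_dvd_of_eval_eq_zero (RatFunc.denom_mul_dvd f g) h
    rw [eval_mul] at this
    exact mul_ne_zero hf hg this
  one_mem' := by simp
  add_mem' {f g} hf hg h := by
    have := eval_eq_zero_of_dvd_of_eval_eq_zero (RatFunc.denom_add_dvd f g) h
    rw [eval_mul] at this
    exact mul_ne_zero hf hg this
  zero_mem' := by simp
  neg_mem' {f} hf h := by
    have hd : (-f).denom ∣ f.denom := by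
      rw [RatFunc.denom_dvd f.denom_ne_zero]
      refine ⟨-f.num, ?_⟩
      rw [map_neg, neg_div, RatFunc.num_div_denom]
    exact hf (eval_eq_zero_of_dvd_of_eval_eq_zero hd h)

theorem mem_holAt {p : ℂ} {f : RatFunc ℂ} : f ∈ holAt p ↔ f.denom.eval p ≠ 0 := Iff.rfl

/-- Evaluation at `p` of rational functions holomorphic at `p`. -/
def holEval (p : ℂ) : holAt p →+* ℂ where
  toFun f := RatFunc.eval (RingHom.id ℂ) p f
  map_one' := by simp
  map_zero' := by simp
  map_mul' f g := RatFunc.eval_mul (f := RingHom.id ℂ) (a := p) f.2 g.2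
  map_add' f g := RatFunc.eval_add (f := RingHom.id ℂ) (a := p) f.2 g.2

theorem div_mem_holAt {p : ℂ} (g : ℂ[X]) {h : ℂ[X]} (hh : h.eval p ≠ 0) :
    algebraMap ℂ[X] (RatFunc ℂ) g / algebraMap ℂ[X] (RatFunc ℂ) h ∈ holAt p := fun h0 =>
  hh (eval_eq_zero_of_dvd_of_eval_eq_zero (RatFunc.denom_div_dvd g h) h0)

theorem eval_div_of_eval_ne_zero {p : ℂ} (g : ℂ[X]) {h : ℂ[X]} (hh : h.eval p ≠ 0) :
    RatFunc.eval (RingHom.id ℂ) p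
      (algebraMap ℂ[X] (RatFunc ℂ) g / algebraMap ℂ[X] (RatFunc ℂ) h) =
        g.eval p / h.eval p := by
  have hh0 : h ≠ 0 := by rintro rfl; simp at hh
  have hm := RatFunc.eval_mul (f := RingHom.id ℂ) (a := p) (div_mem_holAt g hh)
    (y := algebraMap ℂ[X] (RatFunc ℂ) h) (by simp)
  rw [div_mul_cancel₀ _ (RatFunc.algebraMap_ne_zero hh0)] at hm
  simp only [RatFunc.eval_algebraMap, Algebra.algebraMap_self, RingHom.id_apply, eval₂_id] at hm
  rw [eq_div_iff hh, ← hm]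

/-- If `p` is a zero of `g` and `h` of equal order, then `g / h` is a unit at `p`. -/
theorem eval_div_ne_zero_of_rootMultiplicity_eq {p : ℂ} {g h : ℂ[X]} (hg : g ≠ 0) (hh : h ≠ 0)
    (hm : rootMultiplicity p g = rootMultiplicity p h) :
    algebraMap ℂ[X] (RatFunc ℂ) g / algebraMap ℂ[X] (RatFunc ℂ) h ∈ holAt p ∧
    RatFunc.eval (RingHom.id ℂ) p
      (algebraMap ℂ[X] (RatFunc ℂ) g / algebraMap ℂ[X] (RatFunc ℂ) h) ≠ 0 := by
  obtain ⟨u, hu, hup⟩ := exists_eq_pow_rootMultiplicity_mul_and_not_dvd g hg p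
  obtain ⟨v, hv, hvp⟩ := exists_eq_pow_rootMultiplicity_mul_and_not_dvd h hh p
  rw [dvd_iff_isRoot, IsRoot.def] at hup hvp
  have hX : algebraMap ℂ[X] (RatFunc ℂ) ((X - C p) ^ rootMultiplicity p h) ≠ 0 :=
    RatFunc.algebraMap_ne_zero (pow_ne_zero _ (X_sub_C_ne_zero p))
  rw [hm] at hu
  have he : algebraMap ℂ[X] (RatFunc ℂ) g / algebraMap ℂ[X] (RatFunc ℂ) h =
      algebraMap ℂ[X] (RatFunc ℂ) u / algebraMap ℂ[X] (RatFunc ℂ) v := by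
    rw [hu, hv, map_mul, map_mul, ← hv, mul_div_mul_left _ _ hX]
  rw [he, eval_div_of_eval_ne_zero u hvp]
  exact ⟨div_mem_holAt u hvp, div_ne_zero hup hvp⟩

/-- A zero compensates a simple pole. -/
theorem mul_mem_holAt_of_isRoot {p : ℂ} {g h g' h' : ℂ[X]} (hg : g.eval p = 0)
    (hh : h.eval p ≠ 0) (hh' : h' ≠ 0) (hm : rootMultiplicity p h' ≤ 1) :
    algebraMap ℂ[X] (RatFunc ℂ) g / algebraMap ℂ[X] (RatFunc ℂ) h *
      (algebraMap ℂ[X] (RatFunc ℂ) g' / algebraMap ℂ[X] (RatFunc ℂ) h') ∈ holAt p := by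
  by_cases hr : h'.eval p = 0
  · obtain ⟨u, rfl⟩ := dvd_iff_isRoot.2 hg
    obtain ⟨v, hv, hvp⟩ := exists_eq_pow_rootMultiplicity_mul_and_not_dvd h' hh' p
    have h1 : rootMultiplicity p h' = 1 :=
      le_antisymm hm ((rootMultiplicity_pos hh').2 hr)
    rw [h1, pow_one] at hv
    rw [dvd_iff_isRoot, IsRoot.def] at hvp
    have hX : algebraMap ℂ[X] (RatFunc ℂ) (X - C p) ≠ 0 :=
      RatFunc.algebraMap_ne_zero (X_sub_C_ne_zero p)
    have he : algebraMap ℂ[X] (RatFunc ℂ) ((X - C p) * u) / algebraMap ℂ[X] (RatFunc ℂ) h *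
        (algebraMap ℂ[X] (RatFunc ℂ) g' / algebraMap ℂ[X] (RatFunc ℂ) h') =
        algebraMap ℂ[X] (RatFunc ℂ) (u * g') / algebraMap ℂ[X] (RatFunc ℂ) (h * v) := by
      rw [hv, div_mul_div_comm, ← map_mul, ← map_mul,
        show (X - C p) * u * g' = (X - C p) * (u * g') by ring,
        show h * ((X - C p) * v) = (X - C p) * (h * v) by ring, map_mul _ (X - C p),
        map_mul _ (X - C p), mul_div_mul_left _ _ hX]
    rw [he]
    exact div_mem_holAt _ (by rw [eval_mul]; exact mul_ne_zero hh hvp)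
  · exact mul_mem (div_mem_holAt g hh) (div_mem_holAt g' hr)

theorem comp_C_mul_X_ne_zero {c : ℂ} (hc : c ≠ 0) {f : ℂ[X]} (hf : f ≠ 0) :
    f.comp (C c * X) ≠ 0 := by
  intro h
  rcases comp_eq_zero_iff.1 h with h | ⟨-, h⟩
  · exact hf h
  · have := congrArg (fun g => coeff g 1) h
    simp [coeff_C] at this
    exact hc this

/-- `qshift c` as a ring homomorphism. -/
def qshiftHom (c : ℂ) (hc : c ≠ 0) : RatFunc ℂ →+* RatFunc ℂ :=
  RatFunc.mapRingHom (compRingHom (C c * X)) fun f hf => by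
    rw [Submonoid.mem_comap]
    exact mem_nonZeroDivisors_of_ne_zero
      (comp_C_mul_X_ne_zero hc (nonZeroDivisors.ne_zero hf))

theorem qshiftHom_apply {c : ℂ} (hc : c ≠ 0) (f : RatFunc ℂ) :
    qshiftHom c hc f = qshift c f := by
  rw [qshiftHom, RatFunc.coe_mapRingHom_eq_coe_map, RatFunc.map_apply]
  rfl

theorem qshift_div {c : ℂ} (hc : c ≠ 0) (g h : ℂ[X]) :
    qshift c (algebraMap ℂ[X] (RatFunc ℂ) g / algebraMap ℂ[X] (RatFunc ℂ) h) =
      algebraMap ℂ[X] (RatFunc ℂ) (g.comp (C c * X)) /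
        algebraMap ℂ[X] (RatFunc ℂ) (h.comp (C c * X)) := by
  rw [← qshiftHom_apply hc, qshiftHom, RatFunc.coe_mapRingHom_eq_coe_map, RatFunc.map_apply_div]
  rfl

theorem qshift_qshift {c d : ℂ} (hd : d ≠ 0) (f : RatFunc ℂ) :
    qshift d (qshift c f) = qshift (c * d) f := by
  rw [qshift.eq_def c, qshift_div hd, comp_assoc, comp_assoc, qshift]
  simp [mul_assoc]

theorem qshift_mem_holAt {c p : ℂ} {f : RatFunc ℂ} (hf : f ∈ holAt (c * p)) :
    qshift c f ∈ holAt p :=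
  div_mem_holAt _ (by simpa [eval_comp] using mem_holAt.1 hf)

theorem rootMultiplicity_comp_C_mul_X {c : ℂ} (hc : c ≠ 0) (f : ℂ[X]) (p : ℂ) :
    rootMultiplicity p (f.comp (C c * X)) = rootMultiplicity (c * p) f := by
  simpa using rootMultiplicity_comp_C_mul_X_add_C f c 0 p hc.isUnit

theorem regularAt_of_mem_holAt {n : ℕ} {p : ℂ} {M : Matrix (Fin n) (Fin n) (RatFunc ℂ)}
    (hM : ∀ i j, M i j ∈ holAt p) (hdet : RatFunc.eval (RingHom.id ℂ) p M.det ≠ 0) :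
    RegularAt M p := by
  refine ⟨hM, ?_⟩
  let M' : Matrix (Fin n) (Fin n) (holAt p) := Matrix.of fun i j => ⟨M i j, hM i j⟩
  have h1 : ((M'.det : holAt p) : RatFunc ℂ) = M.det :=
    (holAt p).subtype.map_det M'
  have h2 : holEval p M'.det =
      (Matrix.of fun i j => RatFunc.eval (RingHom.id ℂ) p (M i j)).det :=
    (holEval p).map_det M'
  rw [← h2]
  rw [← h1] at hdet
  exact hdet

theorem det_companion {n : ℕ} (hn : n ≠ 0) (t : ℤ → RatFunc ℂ) :
    (companion n t).det = t n := by
  obtain ⟨m, rfl⟩ := Nat.exists_eq_succ_of_ne_zero hn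
  rw [Matrix.det_succ_column _ (Fin.last m), Finset.sum_eq_single 0]
  · have : (companion (m + 1) t).submatrix (Fin.succAbove 0) (Fin.last m).succAbove = 1 := by
      ext i j
      by_cases h : i = j <;>
        simp [companion, Matrix.one_apply, h, Fin.val_inj]
    rw [this]
    have hs : ((-1 : RatFunc ℂ)) ^ m * (-1) ^ m = 1 := by rw [← mul_pow]; simp
    simp [companion, ← mul_assoc, hs]
  · intro i _ hi
    have h1 : (i : ℕ) ≠ m + 1 := i.2.ne
    simp [companion, hi, h1]
  · simp

/-- Solutions of a linear recurrence whose coefficients may leave a subring `O` at the times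
`2 - n, …, 0` stay in `O`, provided the coefficients cancel as in the hypotheses. -/
theorem recurrence_mem {K : Type*} [Field K] (O : Subring K) (n : ℕ) (T : ℤ → ℤ → K)
    (h1 : ∀ k m : ℤ, 1 ≤ k → k ≤ n →
      (1 ≤ m ∨ m ≤ 1 - n ∨ (k ≠ n + m ∧ k ≠ n + m - 1)) → T k m ∈ O)
    (h2 : ∀ k k' m : ℤ, 2 ≤ k → k ≤ n → 1 ≤ k' → k' ≤ n → 2 - n ≤ m → m ≤ 0 →
      T k (1 - n) * T k' m ∈ O)
    (h3 : ∀ k : ℤ, 1 ≤ k → k ≤ n - 1 →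
      T k (k + 1 - n) * T 1 (1 - n) - T (k + 1) (k + 1 - n) ∈ O)
    (y : ℤ → K) (m₀ : ℤ) (hm₀ : m₀ ≤ 1 - n)
    (hy : ∀ m, m₀ ≤ m → y (m + 1) =
      ∑ k ∈ Finset.range n, (-1) ^ k * T (k + 1) m * y (m - k))
    (hinit : ∀ m, m₀ - n < m → m ≤ m₀ → y m ∈ O) :
    ∀ m, m₀ - n < m → y m ∈ O := by
  suffices H : ∀ l : ℕ, ∀ m, m₀ - n < m → m ≤ m₀ + l → y m ∈ O by
    intro m hm
    exact H (m - m₀).toNat m hm (by omega)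
  intro l
  induction l with
  | zero => intro m hm hm'; exact hinit m hm (by simpa using hm')
  | succ l ih =>
    intro m' hm hm'
    rcases lt_or_ge m' (m₀ + l + 1) with hlt | hge
    · exact ih m' hm (by omega)
    obtain ⟨m, rfl⟩ : ∃ m, m' = m + 1 := ⟨m' - 1, by ring⟩
    have hmm : m = m₀ + l := by push_cast at hm'; omega
    have hO : ∀ k : ℕ, k < n → y (m - k) ∈ O := fun k hk => ih _ (by omega) (by omega)
    have hsgn : ∀ k : ℕ, (-1 : K) ^ k ∈ O := fun k => pow_mem (neg_mem (one_mem _)) _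
    rw [hy m (by omega)]
    by_cases hc : 1 ≤ m ∨ m ≤ 1 - n
    · refine sum_mem fun k hk => ?_
      rw [Finset.mem_range] at hk
      refine mul_mem (mul_mem (hsgn k) (h1 _ _ (by omega) (by omega) ?_)) (hO k hk)
      tauto
    push Not at hc
    obtain ⟨κ, hκ⟩ : ∃ κ : ℕ, m = κ + 2 - n := ⟨(m + n - 2).toNat, by omega⟩
    have hκn : κ + 1 < n := by omega
    have hA : κ ∈ Finset.range n := by rw [Finset.mem_range]; omega
    have hB : κ + 1 ∈ (Finset.range n).erase κ := by
      rw [Finset.mem_erase, Finset.mem_range]; omega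
    rw [← Finset.add_sum_erase _ _ hA, ← Finset.add_sum_erase _ _ hB, ← add_assoc]
    refine add_mem ?_ (sum_mem fun k hk => ?_)
    swap
    · rw [Finset.mem_erase, Finset.mem_erase, Finset.mem_range] at hk
      refine mul_mem (mul_mem (hsgn k) (h1 _ _ (by omega) (by omega) ?_)) (hO k (by omega))
      omega
    have e1 : y (m - (κ : ℕ)) =
        T 1 (1 - n) * y (1 - n) + ∑ k ∈ (Finset.range n).erase 0,
          (-1) ^ k * T (k + 1) (1 - n) * y (1 - n - k) := by
      rw [show m - (κ : ℤ) = (1 - n : ℤ) + 1 by omega, hy _ hm₀,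
        ← Finset.add_sum_erase _ _ (Finset.mem_range.2 (by omega : 0 < n))]
      simp
    have e2 : y (m - ((κ + 1 : ℕ) : ℤ)) = y (1 - n) := by
      congr 1; push_cast; omega
    have hm3 : m = (κ + 1 : ℤ) + 1 - n := by omega
    rw [e1, e2, show (-1) ^ κ * T (κ + 1) m * (T 1 (1 - n) * y (1 - n) +
        ∑ k ∈ (Finset.range n).erase 0, (-1) ^ k * T (k + 1) (1 - n) * y (1 - n - k)) +
        (-1) ^ (κ + 1) * T ((κ + 1 : ℕ) + 1) m * y (1 - n) =
        (-1) ^ κ * ((T (κ + 1) m * T 1 (1 - n) - T ((κ + 1 : ℤ) + 1) m) * y (1 - n) +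
          ∑ k ∈ (Finset.range n).erase 0,
            (-1) ^ k * (T (k + 1) (1 - n) * T (κ + 1) m) * y (1 - n - k)) by
      rw [mul_add, mul_add (_ ^ κ), Finset.mul_sum, Finset.mul_sum]
      have : ∀ k : ℕ, (-1) ^ κ * T (κ + 1) m * ((-1) ^ k * T (k + 1) (1 - n) * y (1 - n - k)) =
        (-1) ^ κ * ((-1) ^ k * (T (k + 1) (1 - n) * T (κ + 1) m) * y (1 - n - k)) :=
        fun k => by ring
      simp only [this]
      push_cast
      ring]
    refine mul_mem (hsgn κ) (add_mem (mul_mem ?_ ?_) (sum_mem fun k hk => ?_))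
    · have := h3 (κ + 1) (by omega) (by omega)
      rwa [← hm3] at this
    · rw [← e2]; exact hO _ hκn
    · rw [Finset.mem_erase, Finset.mem_range] at hk
      refine mul_mem (mul_mem (hsgn k) (h2 _ _ _ ?_ ?_ ?_ ?_ ?_ ?_)) (ih _ ?_ ?_) <;> omega

theorem map_qshift_companion {c : ℂ} (hc : c ≠ 0) (n : ℕ) (t : ℤ → RatFunc ℂ) :
    (companion n t).map (qshift c) = companion n fun k => qshift c (t k) := by
  ext i j
  simp only [companion, Matrix.map_apply, Matrix.of_apply, ← qshiftHom_apply hc]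
  split_ifs <;> simp

theorem companion_mul_apply_zero {n : ℕ} (hn : 0 < n) (t : ℤ → RatFunc ℂ)
    (M : Matrix (Fin n) (Fin n) (RatFunc ℂ)) (c : Fin n) :
    (companion n t * M) ⟨0, hn⟩ c = ∑ k : Fin n, (-1) ^ (k : ℕ) * t ((k : ℕ) + 1) * M k c := by
  simp [Matrix.mul_apply, companion]

theorem companion_mul_apply_succ {n i : ℕ} (hi : i + 1 < n) (t : ℤ → RatFunc ℂ)
    (M : Matrix (Fin n) (Fin n) (RatFunc ℂ)) (c : Fin n) :
    (companion n t * M) ⟨i + 1, hi⟩ c = M ⟨i, by omega⟩ c := by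
  rw [Matrix.mul_apply, Finset.sum_eq_single ⟨i, by omega⟩]
  · simp [companion]
  · intro k _ hk
    have : i ≠ k := fun h => hk (Fin.ext h.symm)
    simp [companion, this]
  · simp

/-- The ordered product `F (m + l - 1) * ⋯ * F m`. -/
def descProd {M : Type*} [Monoid M] (F : ℤ → M) (m : ℤ) (l : ℕ) : M :=
  ((List.range l).map fun k : ℕ => F (m + l - 1 - k)).prod

theorem descProd_zero {M : Type*} [Monoid M] (F : ℤ → M) (m : ℤ) : descProd F m 0 = 1 := rfl

theorem descProd_succ {M : Type*} [Monoid M] (F : ℤ → M) (m : ℤ) (l : ℕ) :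
    descProd F m (l + 1) = F (m + l) * descProd F m l := by
  rw [descProd, List.range_succ_eq_map, List.map_cons, List.prod_cons, List.map_map, descProd]
  congr 2
  · push_cast; ring_nf
  · refine List.map_congr_left fun k _ => ?_
    rw [Function.comp_apply]
    push_cast
    ring_nf

theorem descProd_companion_mem (O : Subring (RatFunc ℂ)) (n : ℕ) (T : ℤ → ℤ → RatFunc ℂ)
    (h1 : ∀ k m : ℤ, 1 ≤ k → k ≤ n →
      (1 ≤ m ∨ m ≤ 1 - n ∨ (k ≠ n + m ∧ k ≠ n + m - 1)) → T k m ∈ O)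
    (h2 : ∀ k k' m : ℤ, 2 ≤ k → k ≤ n → 1 ≤ k' → k' ≤ n → 2 - n ≤ m → m ≤ 0 →
      T k (1 - n) * T k' m ∈ O)
    (h3 : ∀ k : ℤ, 1 ≤ k → k ≤ n - 1 →
      T k (k + 1 - n) * T 1 (1 - n) - T (k + 1) (k + 1 - n) ∈ O)
    (m₀ : ℤ) (hm₀ : m₀ ≤ 1 - n) (l : ℕ) (i c : Fin n) :
    descProd (fun m => companion n fun k => T k m) m₀ l i c ∈ O := by
  have hn : 0 < n := i.pos
  set P := descProd (fun m => companion n fun k => T k m) m₀ with hP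
  let y : ℤ → RatFunc ℂ := fun z =>
    if z ≤ m₀ then if (m₀ - z).toNat = c then 1 else 0 else P (z - m₀).toNat ⟨0, hn⟩ c
  have key : ∀ (l : ℕ) (i : ℕ) (hi : i < n), P l ⟨i, hi⟩ c = y (m₀ + l - i) := by
    intro l
    induction l with
    | zero =>
      intro i hi
      simp [hP, descProd_zero, y, Matrix.one_apply, Fin.ext_iff]
    | succ l ih =>
      intro i hi
      cases i with
      | zero =>
        have : ¬ (m₀ + (l + 1 : ℕ) - (0 : ℕ) ≤ m₀) := by omega
        simp only [y, if_neg this]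
        congr 2
        omega
      | succ i =>
        rw [hP, descProd_succ, companion_mul_apply_succ, ← hP, ih]
        congr 1
        push_cast
        ring
  rw [key l i i.2]
  refine recurrence_mem O n T h1 h2 h3 y m₀ hm₀ (fun m hm => ?_) (fun m _ hm => ?_) _
    (by have := i.2; omega)
  · obtain ⟨l, rfl⟩ : ∃ l : ℕ, m = m₀ + l := ⟨(m - m₀).toNat, by omega⟩
    have := key (l + 1) 0 hn
    rw [hP, descProd_succ, companion_mul_apply_zero, ← hP] at this
    rw [Finset.sum_range, show m₀ + (l : ℤ) + 1 = m₀ + (l + 1 : ℕ) - (0 : ℕ) by push_cast; ring,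
      ← this]
    exact Finset.sum_congr rfl fun k _ => by rw [key l k k.2]
  · simp only [y, if_pos hm]
    split_ifs
    exacts [one_mem _, zero_mem _]

/-- If the order of `A (m + 1)` at `p` is that of `B m`, the orders of the ratios `B m / A m`
telescope. -/
theorem exists_descProd_div (p : ℂ) (A B : ℤ → ℂ[X]) (hA : ∀ m, A m ≠ 0) (hB : ∀ m, B m ≠ 0)
    (h : ∀ m, rootMultiplicity p (A (m + 1)) = rootMultiplicity p (B m)) (m₀ : ℤ) (l : ℕ) :
    ∃ U V : ℂ[X], U ≠ 0 ∧ V ≠ 0 ∧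
      descProd (fun m => algebraMap ℂ[X] (RatFunc ℂ) (B m) /
        algebraMap ℂ[X] (RatFunc ℂ) (A m)) m₀ l =
          algebraMap ℂ[X] (RatFunc ℂ) U / algebraMap ℂ[X] (RatFunc ℂ) V ∧
      rootMultiplicity p U + rootMultiplicity p (A m₀) =
        rootMultiplicity p V + rootMultiplicity p (A (m₀ + l)) := by
  induction l with
  | zero => exact ⟨1, 1, one_ne_zero, one_ne_zero, by simp [descProd_zero], by simp⟩
  | succ l ih =>
    obtain ⟨U, V, hU, hV, he, hm⟩ := ih
    refine ⟨B (m₀ + l) * U, A (m₀ + l) * V, mul_ne_zero (hB _) hU, mul_ne_zero (hA _) hV, ?_, ?_⟩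
    · rw [descProd_succ, he, div_mul_div_comm, map_mul, map_mul]
    · rw [rootMultiplicity_mul (mul_ne_zero (hB _) hU),
        rootMultiplicity_mul (mul_ne_zero (hA _) hV), Nat.cast_succ, ← add_assoc, h]
      omega

theorem det_descProd {n : ℕ} (F : ℤ → Matrix (Fin n) (Fin n) (RatFunc ℂ)) (m : ℤ) (l : ℕ) :
    (descProd F m l).det = descProd (fun m => (F m).det) m l := by
  induction l with
  | zero => simp [descProd_zero]
  | succ l ih => rw [descProd_succ, descProd_succ, Matrix.det_mul, ih]

theorem zpow_mul_eq_iff {q s : ℂ} (hq0 : q ≠ 0) (hq1 : ‖q‖ < 1) (hs : s ≠ 0) {m m' : ℤ} :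
    q ^ m * s = q ^ m' * s ↔ m = m' := by
  refine ⟨fun h => ?_, fun h => by rw [h]⟩
  have := congrArg norm (mul_right_cancel₀ hs h)
  rw [norm_zpow, norm_zpow] at this
  exact zpow_right_injective₀ (norm_pos_iff.2 hq0) hq1.ne this

/-- The order at `q ^ m * s` of a polynomial whose zeros on `q ^ ℤ * s` are simple and located
at `q ^ (-j) * s` for `j` in a prescribed set. -/
theorem rootMultiplicity_zpow_mul {q s : ℂ} (hq0 : q ≠ 0) (hq1 : ‖q‖ < 1) (hs : s ≠ 0)
    {f : ℂ[X]} (S : Set ℤ) [DecidablePred (· ∈ S)]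
    (hsimple : ∀ m ∈ S, rootMultiplicity (q ^ m * s) f = 1)
    (hother : ∀ m : ℤ, f.IsRoot (q ^ m * s) → ∃ m' ∈ S, q ^ m * s = q ^ m' * s) (m : ℤ) :
    rootMultiplicity (q ^ m * s) f = if m ∈ S then 1 else 0 := by
  split_ifs with h
  · exact hsimple m h
  · refine rootMultiplicity_eq_zero fun hr => h ?_
    obtain ⟨m', hm', he⟩ := hother m hr
    rwa [(zpow_mul_eq_iff hq0 hq1 hs).1 he]

/-- Proposition 2.5: a sufficient condition for the points
`q^{-j} s`, `0 ≤ j ≤ n-1`, to be apparent singularities. -/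
theorem apparent_of_conditions (q : ℂ) (hq0 : q ≠ 0) (hq1 : ‖q‖ < 1)
    (n : ℕ) (a : ℕ → Polynomial ℂ) (ha0 : a 0 ≠ 0) (han : a n ≠ 0)
    (s : ℂ) (hs : s ≠ 0)
    (hsimple0 : ∀ j : ℕ, (j : ℤ) ≤ (n : ℤ) - 2 →
      rootMultiplicity (q ^ (-(j : ℤ)) * s) (a 0) = 1)
    (hsimplen : ∀ j : ℕ, 1 ≤ j → (j : ℤ) ≤ (n : ℤ) - 1 →
      rootMultiplicity (q ^ (-(j : ℤ)) * s) (a n) = 1)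
    (hother0 : ∀ m : ℤ, (a 0).IsRoot (q ^ m * s) →
      ∃ j : ℕ, (j : ℤ) ≤ (n : ℤ) - 2 ∧ q ^ m * s = q ^ (-(j : ℤ)) * s)
    (hothern : ∀ m : ℤ, (a n).IsRoot (q ^ m * s) →
      ∃ j : ℕ, 1 ≤ j ∧ (j : ℤ) ≤ (n : ℤ) - 1 ∧ q ^ m * s = q ^ (-(j : ℤ)) * s)
    -- (i): for 1 ≤ k ≤ n-1, t_k is holomorphic at q^{-j} s for j ≠ n-k, n-k-1
    (hcond1 : ∀ k : ℕ, 1 ≤ k → (k : ℤ) ≤ (n : ℤ) - 1 → ∀ j : ℤ,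
      j ≠ (n : ℤ) - k → j ≠ (n : ℤ) - k - 1 →
      (tcoef n a (k : ℤ)).denom.eval (q ^ (-j) * s) ≠ 0)
    -- (ii): for 2 ≤ k ≤ n-1, t_k(q^{-n+1} s) = 0
    (hcond2 : ∀ k : ℕ, 2 ≤ k → (k : ℤ) ≤ (n : ℤ) - 1 →
      RatFunc.eval (RingHom.id ℂ) (q ^ (1 - (n : ℤ)) * s) (tcoef n a (k : ℤ)) = 0)
    -- (iii): for 1 ≤ k ≤ n-1, t_k(q^{-n+k+1}x)·t_1(q^{-n+1}x) − t_{k+1}(q^{-n+k+1}x)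
    -- is holomorphic at x = s
    (hcond3 : ∀ k : ℕ, 1 ≤ k → (k : ℤ) ≤ (n : ℤ) - 1 →
      (qshift (q ^ ((k : ℤ) + 1 - n)) (tcoef n a (k : ℤ)) *
          qshift (q ^ (1 - (n : ℤ))) (tcoef n a 1) -
        qshift (q ^ ((k : ℤ) + 1 - n)) (tcoef n a ((k : ℤ) + 1))).denom.eval s ≠ 0) :
    ∀ j : ℕ, (j : ℤ) ≤ (n : ℤ) - 1 →
      IsApparent q (companion n (tcoef n a)) (q ^ (-(j : ℤ)) * s) := by
  intro j hj
  have hn : n ≠ 0 := by omega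
  have hqz : ∀ m : ℤ, q ^ m ≠ 0 := fun m => zpow_ne_zero m hq0
  have hμ0 := rootMultiplicity_zpow_mul hq0 hq1 hs (f := a 0) {m : ℤ | 2 - (n : ℤ) ≤ m ∧ m ≤ 0}
    (fun m hm => by
      have := hsimple0 (-m).toNat (by have := hm.1; have := hm.2; omega)
      rwa [show (-((-m).toNat : ℤ)) = m by have := hm.2; omega] at this)
    (fun m hr => by
      obtain ⟨i, hi, he⟩ := hother0 m hr
      exact ⟨-i, ⟨by omega, by omega⟩, he⟩)
  have hμn := rootMultiplicity_zpow_mul hq0 hq1 hs (f := a n) {m : ℤ | 1 - (n : ℤ) ≤ m ∧ m ≤ -1}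
    (fun m hm => by
      have := hsimplen (-m).toNat (by have := hm.2; omega) (by have := hm.1; have := hm.2; omega)
      rwa [show (-((-m).toNat : ℤ)) = m by have := hm.2; omega] at this)
    (fun m hr => by
      obtain ⟨i, hi1, hi, he⟩ := hothern m hr
      exact ⟨-i, ⟨by omega, by omega⟩, he⟩)
  simp only [Set.mem_ofPred_eq] at hμ0 hμn
  set p := q ^ (-(j : ℤ)) * s with hp
  have hqp : ∀ m : ℤ, q ^ (m + j) * p = q ^ m * s := fun m => by
    rw [hp, ← mul_assoc, ← zpow_add₀ hq0, add_neg_cancel_right]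
  let T : ℤ → ℤ → RatFunc ℂ := fun k m => qshift (q ^ (m + j)) (tcoef n a k)
  have htcoef : ∀ k : ℕ, k ≤ n → tcoef n a k =
      algebraMap ℂ[X] (RatFunc ℂ) (a k) / algebraMap ℂ[X] (RatFunc ℂ) (a 0) := fun k hk => by
    rw [tcoef, if_pos ⟨by omega, by omega⟩, Int.toNat_natCast]
  have hTdiv : ∀ (k : ℕ) (m : ℤ), k ≤ n → T k m =
      algebraMap ℂ[X] (RatFunc ℂ) ((a k).comp (C (q ^ (m + j)) * X)) /
        algebraMap ℂ[X] (RatFunc ℂ) ((a 0).comp (C (q ^ (m + j)) * X)) := fun k m hk => by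
    simp only [T]
    rw [htcoef k hk, qshift_div (hqz _)]
  have hcomp : ∀ (f : ℂ[X]) (m : ℤ),
      (f.comp (C (q ^ (m + j)) * X)).eval p = f.eval (q ^ m * s) := fun f m => by
    simp [eval_comp, hqp]
  have hmult : ∀ (f : ℂ[X]) (m : ℤ), rootMultiplicity p (f.comp (C (q ^ (m + j)) * X)) =
      rootMultiplicity (q ^ m * s) f := fun f m => by
    rw [rootMultiplicity_comp_C_mul_X (hqz _), hqp]
  have ha0eval : ∀ m : ℤ, (1 ≤ m ∨ m ≤ 1 - n) → (a 0).eval (q ^ m * s) ≠ 0 := fun m hm hr => by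
    have h := (rootMultiplicity_pos ha0).2 hr
    rw [hμ0, if_neg (by omega)] at h
    exact h.false
  have h1 : ∀ k m : ℤ, 1 ≤ k → k ≤ n →
      (1 ≤ m ∨ m ≤ 1 - n ∨ (k ≠ n + m ∧ k ≠ n + m - 1)) → T k m ∈ holAt p := by
    intro k m hk1 hkn hkm
    lift k to ℕ using by omega
    by_cases hm : 1 ≤ m ∨ m ≤ 1 - n
    · rw [hTdiv k m (by omega)]
      exact div_mem_holAt _ (by rw [hcomp]; exact ha0eval m hm)
    · rcases (by omega : k = n ∨ k < n) with rfl | hlt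
      · rw [hTdiv k m le_rfl]
        refine (eval_div_ne_zero_of_rootMultiplicity_eq (comp_C_mul_X_ne_zero (hqz _) han)
          (comp_C_mul_X_ne_zero (hqz _) ha0) ?_).1
        rw [hmult, hmult, hμ0, hμn, if_pos (by omega), if_pos (by omega)]
      · refine qshift_mem_holAt ?_
        rw [hqp, mem_holAt]
        have := hcond1 k (by omega) (by omega) (-m) (by omega) (by omega)
        rwa [neg_neg] at this
  have h2 : ∀ k k' m : ℤ, 2 ≤ k → k ≤ n → 1 ≤ k' → k' ≤ n → 2 - n ≤ m → m ≤ 0 →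
      T k (1 - n) * T k' m ∈ holAt p := by
    intro k k' m hk2 hkn hk1' hkn' _ _
    lift k to ℕ using by omega
    lift k' to ℕ using by omega
    have ha0n := ha0eval (1 - n) (Or.inr le_rfl)
    rw [hTdiv k _ (by omega), hTdiv k' _ (by omega)]
    refine mul_mem_holAt_of_isRoot ?_ (by rwa [hcomp]) (comp_C_mul_X_ne_zero (hqz _) ha0) ?_
    · rw [hcomp]
      rcases (by omega : k = n ∨ k < n) with rfl | hlt
      · refine (rootMultiplicity_pos han).1 ?_
        rw [hμn, if_pos (by omega)]
        exact one_pos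
      · have := hcond2 k (by omega) (by omega)
        rw [htcoef k hlt.le, eval_div_of_eval_ne_zero _ ha0n] at this
        exact (div_eq_zero_iff.1 this).resolve_right ha0n
    · rw [hmult, hμ0]
      split_ifs <;> simp
  have h3 : ∀ k : ℤ, 1 ≤ k → k ≤ n - 1 →
      T k (k + 1 - n) * T 1 (1 - n) - T (k + 1) (k + 1 - n) ∈ holAt p := by
    intro k hk1 hkn
    lift k to ℕ using by omega
    have hjs : q ^ (j : ℤ) * p = s := by simpa using hqp 0
    have h := hcond3 k (by omega) hkn
    rw [← mem_holAt, ← hjs] at h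
    have h := qshift_mem_holAt h
    rw [← qshiftHom_apply (hqz _), map_sub, map_mul, qshiftHom_apply, qshiftHom_apply,
      qshiftHom_apply, qshift_qshift (hqz _), qshift_qshift (hqz _), qshift_qshift (hqz _),
      ← zpow_add₀ hq0, ← zpow_add₀ hq0] at h
    exact h
  refine ⟨n + j, fun N N' hN hN' => ?_⟩
  have hprod : ((List.range (N + N' + 1)).map fun k =>
      (companion n (tcoef n a)).map (qshift (q ^ ((N : ℤ) - (k : ℤ))))).prod =
      descProd (fun m => companion n fun k => T k m) (-N' - j) (N + N' + 1) := by
    rw [descProd, bind_pure_comp, List.map_eq_map, List.map_map]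
    congr 1
    refine List.map_congr_left fun k _ => ?_
    rw [Function.comp_apply, map_qshift_companion (hqz _)]
    simp only [T]
    congr! 4
    push_cast
    ring
  rw [hprod]
  refine regularAt_of_mem_holAt
    (fun i c => descProd_companion_mem (holAt p) n T h1 h2 h3 _ (by omega) _ i c) ?_
  obtain ⟨U, V, hU, hV, he, hm⟩ := exists_descProd_div p
    (fun m => (a 0).comp (C (q ^ (m + j)) * X)) (fun m => (a n).comp (C (q ^ (m + j)) * X))
    (fun m => comp_C_mul_X_ne_zero (hqz _) ha0) (fun m => comp_C_mul_X_ne_zero (hqz _) han)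
    (fun m => by
      rw [hmult, hmult, hμ0, hμn]
      congr 1
      rw [eq_iff_iff]
      omega)
    (-N' - j) (N + N' + 1)
  rw [hmult, hmult, hμ0, hμ0, if_neg (by omega), if_neg (by push_cast; omega)] at hm
  rw [det_descProd]
  simp only [det_companion hn, hTdiv n _ le_rfl]
  rw [he]
  exact (eval_div_ne_zero_of_rootMultiplicity_eq hU hV (by simpa using hm)).2

end
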